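/- arXiv:1112.4122 — 2 statements merged into one kernel-verified Lean document; each statement's English description precedes it below -/
import Mathlib

section
/- Let a < b be real numbers, let r be a positive continuous function on the interval (a,b), and let p be a positive integer. Then for every nonnegative measurable function f on (a,b) for which all the integrals below exist and are finite, ∫_a^b r(x)(∫_x^b f(t) dt)^{p+1} dx ≤ (b−a)^p · sup_{a<x<b} (∫_a^x r(t) dt) · ∫_a^b f(x)^{p+1} dx. -/
open MeasureTheory intervalIntegral Set

/-- Jensen's inequality for the power function on an interval. -/
lemma integral_pow_succ_le {a b : ℝ} (hab : a < b) (p : ℕ) {f : ℝ → ℝ}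
    (hf : ∀ x ∈ Ioo a b, 0 ≤ f x) (hfi : IntervalIntegrable f volume a b)
    (hfp : IntervalIntegrable (fun x => f x ^ (p + 1)) volume a b) :
    (∫ x in a..b, f x) ^ (p + 1) ≤ (b - a) ^ p * ∫ x in a..b, f x ^ (p + 1) := by
  have hba : 0 < b - a := sub_pos.2 hab
  rw [intervalIntegrable_iff_integrableOn_Ioo_of_le hab.le] at hfi hfp
  have jensen := (convexOn_pow (𝕜 := ℝ) (p + 1)).map_set_average_le
    (continuous_pow (p + 1)).continuousOn isClosed_Ici (t := Ioo a b) (μ := volume) (f := f)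
    (by simp [hab]) (by simp)
    ((ae_restrict_iff' measurableSet_Ioo).2 (Filter.Eventually.of_forall hf)) hfi hfp
  simp only [setAverage_eq, Real.volume_real_Ioo_of_le hab.le,
    smul_eq_mul] at jensen
  rw [integral_of_le hab.le, integral_of_le hab.le, integral_Ioc_eq_integral_Ioo,
    integral_Ioc_eq_integral_Ioo]
  have scaled := mul_le_mul_of_nonneg_left jensen (pow_pos hba (p + 1)).le
  rw [← mul_pow, mul_inv_cancel_left₀ hba.ne', pow_succ (b - a) p, mul_assoc,
    mul_inv_cancel_left₀ hba.ne'] at scaled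
  exact scaled

/-- The integral over an interval is at most the supremum of its primitive. -/
lemma integral_le_sSup_primitive {a b : ℝ} (hab : a < b) {r : ℝ → ℝ}
    (hr : ∀ x ∈ Ioo a b, 0 ≤ r x) (hri : IntervalIntegrable r volume a b) :
    ∫ x in a..b, r x ≤ sSup ((fun x => ∫ t in a..x, r t) '' Ioo a b) := by
  have hae : 0 ≤ᵐ[volume.restrict (Ioc a b)] r := by
    rw [← restrict_Ioo_eq_restrict_Ioc]
    exact (ae_restrict_iff' measurableSet_Ioo).2 (Filter.Eventually.of_forall hr)
  have hbdd : BddAbove ((fun x => ∫ t in a..x, r t) '' Ioo a b) := by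
    refine ⟨∫ t in a..b, r t, ?_⟩
    rintro _ ⟨x, hx, rfl⟩
    exact integral_mono_interval le_rfl hx.1.le hx.2.le hae hri
  have hcont : ContinuousWithinAt (fun x => ∫ t in a..x, r t) (Ioo a b) b :=
    (continuousOn_primitive_interval (by
      rwa [uIcc_of_le hab.le, ← intervalIntegrable_iff_integrableOn_Icc_of_le hab.le])
      b right_mem_uIcc).mono (by rw [uIcc_of_le hab.le]; exact Ioo_subset_Icc_self)
  have : (nhdsWithin b (Ioo a b)).NeBot := by
    rw [← mem_closure_iff_nhdsWithin_neBot, closure_Ioo hab.ne]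
    exact right_mem_Icc.2 hab.le
  exact le_of_tendsto hcont.tendsto
    (eventually_mem_nhdsWithin.mono fun x hx => le_csSup hbdd (mem_image_of_mem _ hx))

/-- Theorem 2.12: For positive continuous `r` on `(a,b)`, a positive integer `p`,
and nonnegative measurable `f` (all integrals existing and finite),
`∫_a^b r(x)(∫_x^b f)^(p+1) dx ≤ (b−a)^p · sup_{a<x<b} (∫_a^x r) · ∫_a^b f^(p+1)`. -/
theorem hardy_type_thm_2_12 (a b : ℝ) (hab : a < b) (p : ℕ) (hp : 0 < p) (r f : ℝ → ℝ)
    (hr : ContinuousOn r (Ioo a b)) (hrpos : ∀ x ∈ Ioo a b, 0 < r x)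
    (hfmeas : Measurable f) (hfnonneg : ∀ x ∈ Ioo a b, 0 ≤ f x)
    (hfi : IntervalIntegrable f volume a b)
    (hri : IntervalIntegrable r volume a b)
    (h1 : IntervalIntegrable (fun x => r x * (∫ t in x..b, f t) ^ (p + 1)) volume a b)
    (h2 : IntervalIntegrable (fun x => f x ^ (p + 1)) volume a b) :
    ∫ x in a..b, r x * (∫ t in x..b, f t) ^ (p + 1) ≤
      (b - a) ^ p * sSup ((fun x => ∫ t in a..x, r t) '' Ioo a b) *
        ∫ x in a..b, f x ^ (p + 1) := by
  have hae : 0 ≤ᵐ[volume.restrict (Ioc a b)] f := by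
    rw [← restrict_Ioo_eq_restrict_Ioc]
    exact (ae_restrict_iff' measurableSet_Ioo).2 (Filter.Eventually.of_forall hfnonneg)
  have tail_le : ∀ x ∈ Ioo a b,
      (∫ t in x..b, f t) ^ (p + 1) ≤ (∫ t in a..b, f t) ^ (p + 1) := fun x hx =>
    pow_le_pow_left₀
      (by
        rw [integral_of_le hx.2.le, integral_Ioc_eq_integral_Ioo]
        exact setIntegral_nonneg measurableSet_Ioo
          fun t ht => hfnonneg t ⟨hx.1.trans ht.1, ht.2⟩)
      (integral_mono_interval hx.1.le hx.2.le le_rfl hae hfi) _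
  have hrint : 0 ≤ ∫ x in a..b, r x := by
    rw [integral_of_le hab.le, integral_Ioc_eq_integral_Ioo]
    exact setIntegral_nonneg measurableSet_Ioo fun x hx => (hrpos x hx).le
  have hfpint : 0 ≤ ∫ x in a..b, f x ^ (p + 1) := by
    rw [integral_of_le hab.le, integral_Ioc_eq_integral_Ioo]
    exact setIntegral_nonneg measurableSet_Ioo fun x hx => pow_nonneg (hfnonneg x hx) _
  have hba : 0 ≤ b - a := (sub_pos.2 hab).le
  calc
    _ ≤ ∫ x in a..b, r x * (∫ t in a..b, f t) ^ (p + 1) :=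
      integral_mono_on_of_le_Ioo hab.le h1 (hri.mul_const _) fun x hx =>
        mul_le_mul_of_nonneg_left (tail_le x hx) (hrpos x hx).le
    _ = (∫ x in a..b, r x) * (∫ t in a..b, f t) ^ (p + 1) := integral_mul_const _ _
    _ ≤ (∫ x in a..b, r x) * ((b - a) ^ p * ∫ x in a..b, f x ^ (p + 1)) :=
      mul_le_mul_of_nonneg_left (integral_pow_succ_le hab p hfnonneg hfi h2) hrint
    _ = (b - a) ^ p * (∫ x in a..b, r x) * ∫ x in a..b, f x ^ (p + 1) := by ring
    _ ≤ _ := by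
      gcongr
      exact integral_le_sSup_primitive hab (fun x hx => (hrpos x hx).le) hri
end

section
/- Let a ≤ X < b be real numbers, let p and q be positive real numbers with p + q > 1, and let r and s be positive continuous functions on (a,b) with ∫_a^b s(t)^{−1/(p+q−1)} dt < ∞. If y : [a,b] → ℝ is absolutely continuous (differentiable with integrable derivative) and y(b) = 0, then ∫_X^b r(x)|y(x)|^p |y′(x)|^q dx ≤ K₂(X,b,p,q) · ∫_X^b s(x)|y′(x)|^{p+q} dx, where K₂(X,b,p,q) = (q/(p+q))^{q/(p+q)} · ( ∫_X^b r(x)^{(p+q)/p} s(x)^{−q/p} (∫_x^b s(t)^{−1/(p+q−1)} dt)^{p+q−1} dx )^{p/(p+q)}. -/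
open MeasureTheory intervalIntegral Set

theorem LipschitzOnWith.comp_absolutelyContinuousOnInterval {g f : ℝ → ℝ} {K : NNReal} {t : Set ℝ}
    {a b : ℝ} (hg : LipschitzOnWith K g t) (hf : AbsolutelyContinuousOnInterval f a b)
    (hft : MapsTo f (uIcc a b) t) :
    AbsolutelyContinuousOnInterval (fun x => g (f x)) a b := by
  rw [absolutelyContinuousOnInterval_iff] at hf ⊢
  intro ε hε
  obtain ⟨δ, hδ, h⟩ := hf (ε / (K + 1)) (by positivity)
  refine ⟨δ, hδ, fun E hE hlt => ?_⟩
  calc ∑ i ∈ Finset.range E.1, dist (g (f (E.2 i).1)) (g (f (E.2 i).2))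
      ≤ ∑ i ∈ Finset.range E.1, K * dist (f (E.2 i).1) (f (E.2 i).2) :=
        Finset.sum_le_sum fun i hi =>
          hg.dist_le_mul _ (hft (hE.1 i hi).1) _ (hft (hE.1 i hi).2)
    _ = K * ∑ i ∈ Finset.range E.1, dist (f (E.2 i).1) (f (E.2 i).2) :=
        (Finset.mul_sum _ _ _).symm
    _ ≤ K * (ε / (K + 1)) := by gcongr; exact (h E hE hlt).le
    _ < (K + 1) * (ε / (K + 1)) := by gcongr; linarith
    _ = ε := by field

/-- The tail integral `x ↦ ∫ t in x..b, f t` is absolutely continuous. -/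
theorem absolutelyContinuousOnInterval_integral_left {f : ℝ → ℝ} {a b : ℝ}
    (hf : IntervalIntegrable f volume a b) :
    AbsolutelyContinuousOnInterval (fun x => ∫ t in x..b, f t) a b := by
  have h := (hf.absolutelyContinuousOnInterval_intervalIntegral right_mem_uIcc).fun_neg
  simpa only [← intervalIntegral.integral_symm] using h

theorem intervalIntegrable_rpow_integral_left_mul {f : ℝ → ℝ} {a b α : ℝ} (hα : 0 ≤ α)
    (hf : IntervalIntegrable f volume a b) :
    IntervalIntegrable (fun x => (∫ t in x..b, f t) ^ α * f x) volume a b :=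
  hf.continuousOn_mul <|
    (absolutelyContinuousOnInterval_integral_left hf).continuousOn.rpow_const fun _ _ => .inr hα

theorem integral_rpow_integral_left_mul {f : ℝ → ℝ} {a b α : ℝ} (hα : 0 ≤ α)
    (hf : IntervalIntegrable f volume a b) :
    ∫ x in a..b, (∫ t in x..b, f t) ^ α * f x = (∫ t in a..b, f t) ^ (α + 1) / (α + 1) := by
  have hAC := absolutelyContinuousOnInterval_integral_left hf
  obtain ⟨C, hC⟩ := hAC.exists_bound
  have hcd : ContDiff ℝ 1 fun u : ℝ => u ^ (α + 1) :=
    Real.contDiff_rpow_const_of_le (by norm_num; exact hα)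
  obtain ⟨K, hK⟩ := hcd.contDiffOn.exists_lipschitzOnWith (s := Icc (-C) C) one_ne_zero
    (convex_Icc _ _) isCompact_Icc
  have hAC' := hK.comp_absolutelyContinuousOnInterval hAC fun x hx => abs_le.1 (hC x hx)
  have hFTC := hAC'.integral_deriv_eq_sub
  have hderiv : ∫ x in a..b, deriv (fun x => (∫ t in x..b, f t) ^ (α + 1)) x
      = ∫ x in a..b, -(α + 1) * ((∫ t in x..b, f t) ^ α * f x) := by
    apply intervalIntegral.integral_congr_ae
    filter_upwards [hf.ae_hasDerivAt_integral] with x hx hxab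
    have h1 : HasDerivAt (fun x => ∫ t in x..b, f t) (-f x) x := by
      have := (hx (uIoc_subset_uIcc hxab) b right_mem_uIcc).fun_neg
      simpa only [← intervalIntegral.integral_symm] using this
    have h2 := h1.rpow_const (p := α + 1) (.inr (by linarith))
    rw [h2.deriv, add_sub_cancel_right]
    ring
  rw [hderiv, intervalIntegral.integral_const_mul, intervalIntegral.integral_same,
    Real.zero_rpow (by positivity)] at hFTC
  rw [eq_div_iff (by positivity)]
  linarith

theorem memLp_rpow_inv {Ω : Type*} [MeasurableSpace Ω] {μ : Measure Ω} {f : Ω → ℝ} {α : ℝ}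
    (hα : 0 < α) (hf0 : 0 ≤ᵐ[μ] f) (hf : Integrable f μ) :
    MemLp (fun x => f x ^ α) (ENNReal.ofReal α⁻¹) μ := by
  have hm : AEStronglyMeasurable (fun x => f x ^ α) μ :=
    (hf.aemeasurable.pow_const α).aestronglyMeasurable
  rw [← integrable_norm_rpow_iff hm (by simpa using hα) (by simp)]
  refine hf.congr ?_
  filter_upwards [hf0] with x hx
  rw [ENNReal.toReal_ofReal (by positivity), Real.norm_of_nonneg (Real.rpow_nonneg hx _),
    Real.rpow_rpow_inv hx hα.ne']

section Holder

variable {Ω : Type*} [MeasurableSpace Ω] {μ : Measure Ω} {f g : Ω → ℝ} {α β : ℝ}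

theorem holderConjugate_inv_inv (hα : 0 < α) (hβ : 0 < β) (hαβ : α + β = 1) :
    (α⁻¹).HolderConjugate β⁻¹ where
  inv_add_inv_eq_inv := by simpa using hαβ
  left_pos := by positivity
  right_pos := by positivity

theorem integrable_rpow_mul_rpow (hα : 0 < α) (hβ : 0 < β) (hαβ : α + β = 1)
    (hf0 : 0 ≤ᵐ[μ] f) (hg0 : 0 ≤ᵐ[μ] g) (hf : Integrable f μ) (hg : Integrable g μ) :
    Integrable (fun x => f x ^ α * g x ^ β) μ :=
  have := (holderConjugate_inv_inv hα hβ hαβ).ennrealOfReal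
  (memLp_rpow_inv hα hf0 hf).integrable_mul (memLp_rpow_inv hβ hg0 hg)

/-- The Hölder inequality for weighted geometric means. -/
theorem integral_rpow_mul_rpow_le (hα : 0 < α) (hβ : 0 < β) (hαβ : α + β = 1)
    (hf0 : 0 ≤ᵐ[μ] f) (hg0 : 0 ≤ᵐ[μ] g) (hf : Integrable f μ) (hg : Integrable g μ) :
    ∫ x, f x ^ α * g x ^ β ∂μ ≤ (∫ x, f x ∂μ) ^ α * (∫ x, g x ∂μ) ^ β := by
  have h := integral_mul_le_Lp_mul_Lq_of_nonneg (holderConjugate_inv_inv hα hβ hαβ)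
    (hf0.mono fun x hx => Real.rpow_nonneg hx α) (hg0.mono fun x hx => Real.rpow_nonneg hx β)
    (memLp_rpow_inv hα hf0 hf) (memLp_rpow_inv hβ hg0 hg)
  have hf' : ∫ x, (f x ^ α) ^ α⁻¹ ∂μ = ∫ x, f x ∂μ :=
    integral_congr_ae (hf0.mono fun x hx => Real.rpow_rpow_inv hx hα.ne')
  have hg' : ∫ x, (g x ^ β) ^ β⁻¹ ∂μ = ∫ x, g x ∂μ :=
    integral_congr_ae (hg0.mono fun x hx => Real.rpow_rpow_inv hx hβ.ne')
  simpa only [hf', hg', one_div, inv_inv] using h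

end Holder

theorem ae_restrict_Ioc_of_forall_mem_Ioo {P : ℝ → Prop} {x b : ℝ} (h : ∀ t ∈ Ioo x b, P t) :
    ∀ᵐ t ∂volume.restrict (Ioc x b), P t := by
  rw [← Measure.restrict_congr_set Ioo_ae_eq_Ioc]
  exact ae_restrict_of_forall_mem measurableSet_Ioo h

/-- Weighted Hölder bound for the `L¹` norm of `v` with weight `s` and exponent `n`. -/
theorem integral_abs_le_weighted {s v : ℝ → ℝ} {x b n : ℝ} (hxb : x ≤ b) (hn : 1 < n)
    (hspos : ∀ t ∈ Ioo x b, 0 < s t)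
    (hs : IntervalIntegrable (fun t => s t ^ (-1 / (n - 1))) volume x b)
    (hv : IntervalIntegrable (fun t => s t * |v t| ^ n) volume x b) :
    ∫ t in x..b, |v t| ≤
      (∫ t in x..b, s t ^ (-1 / (n - 1))) ^ ((n - 1) / n) *
        (∫ t in x..b, s t * |v t| ^ n) ^ (1 / n) := by
  have hn1 : 0 < n - 1 := by linarith
  have hn0 : 0 < n := by linarith
  simp only [intervalIntegral.integral_of_le hxb]
  refine le_of_eq_of_le (integral_congr_ae ?_) (integral_rpow_mul_rpow_le (by positivity)
    (by positivity) (by field) (ae_restrict_Ioc_of_forall_mem_Ioo fun t ht => ?_)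
    (ae_restrict_Ioc_of_forall_mem_Ioo fun t ht => ?_) hs.1 hv.1)
  · refine ae_restrict_Ioc_of_forall_mem_Ioo fun t ht => ?_
    have h := hspos t ht
    beta_reduce
    rw [Real.mul_rpow h.le (by positivity), ← Real.rpow_mul h.le,
      ← Real.rpow_mul (abs_nonneg _), ← mul_assoc, ← Real.rpow_add h,
      show -1 / (n - 1) * ((n - 1) / n) + 1 / n = 0 by field, mul_one_div_cancel hn0.ne']
    simp
  · exact Real.rpow_nonneg (hspos t ht).le _
  · exact mul_nonneg (hspos t ht).le (by positivity)

theorem opial_integrand_le {p q r s H G u w : ℝ} (hp : 0 < p) (hq : 0 < q)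
    (hr : 0 < r) (hs : 0 < s) (hH : 0 ≤ H) (hG : 0 ≤ G) (hu : 0 ≤ u) (hw : 0 ≤ w)
    (hbound : u ≤ H ^ ((p + q - 1) / (p + q)) * G ^ (1 / (p + q))) :
    r * u ^ p * w ^ q ≤
      (r ^ ((p + q) / p) * s ^ (-q / p) * H ^ (p + q - 1)) ^ (p / (p + q)) *
        (G ^ (p / q) * (s * w ^ (p + q))) ^ (q / (p + q)) := by
  have hup := Real.rpow_le_rpow hu hbound hp.le
  calc r * u ^ p * w ^ q
      ≤ r * (H ^ ((p + q - 1) / (p + q)) * G ^ (1 / (p + q))) ^ p * w ^ q := by gcongr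
    _ = _ := by
      have hs1 : s ^ (-q / p * (p / (p + q))) * s ^ (q / (p + q)) = 1 := by
        rw [← Real.rpow_add hs, show -q / p * (p / (p + q)) + q / (p + q) = 0 by field,
          Real.rpow_zero]
      have e1 : (p + q) / p * (p / (p + q)) = 1 := by field
      have e2 : (p + q) * (q / (p + q)) = q := by field
      have e3 : (p + q - 1) * (p / (p + q)) = (p + q - 1) / (p + q) * p := by field
      have e4 : p / q * (q / (p + q)) = 1 / (p + q) * p := by field
      rw [Real.mul_rpow (by positivity) (by positivity), Real.mul_rpow (by positivity)
        (by positivity), Real.mul_rpow (by positivity) (by positivity),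
        Real.mul_rpow (by positivity) (by positivity), Real.mul_rpow hs.le (by positivity)]
      simp only [← Real.rpow_mul hr.le, ← Real.rpow_mul hs.le, ← Real.rpow_mul hH,
        ← Real.rpow_mul hG, ← Real.rpow_mul hw, e1, e2, e3, e4, Real.rpow_one]
      linear_combination (-(r * H ^ ((p + q - 1) / (p + q) * p) * G ^ (1 / (p + q) * p)
        * w ^ q)) * hs1

/-- Theorem 2.25 (Opial-type inequality of Beesack–Das): let `a ≤ X < b`, let
`p, q > 0` with `p + q > 1`, and let `r, s` be positive continuous functions on
`(a,b)` with `∫_a^b s(t)^(−1/(p+q−1)) dt < ∞`. If `y` is absolutely continuous on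
`[a,b]` (with a.e. derivative `y'` and `y(x) = −∫_x^b y'(t) dt`) and `y(b) = 0`, then
`∫_X^b r|y|^p |y'|^q ≤ K₂(X,b,p,q) · ∫_X^b s|y'|^(p+q)`, where
`K₂(X,b,p,q) = (q/(p+q))^(q/(p+q)) ·
(∫_X^b r^((p+q)/p) s^(−q/p) (∫_x^b s^(−1/(p+q−1)))^(p+q−1) dx)^(p/(p+q))`. -/
theorem opial_type_thm_2_25 (a b X : ℝ) (haX : a ≤ X) (hXb : X < b)
    (p q : ℝ) (hp : 0 < p) (hq : 0 < q) (hpq : 1 < p + q) (r s : ℝ → ℝ)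
    (hr : ContinuousOn r (Ioo a b)) (hrpos : ∀ x ∈ Ioo a b, 0 < r x)
    (hs : ContinuousOn s (Ioo a b)) (hspos : ∀ x ∈ Ioo a b, 0 < s x)
    (hsint : IntervalIntegrable (fun t => s t ^ (-1 / (p + q - 1))) volume a b)
    (y y' : ℝ → ℝ)
    (hy'int : IntervalIntegrable y' volume a b)
    (hAC : ∀ x ∈ Icc a b, y x = -∫ t in x..b, y' t)
    (hyb : y b = 0)
    (h1 : IntervalIntegrable (fun x => r x * |y x| ^ p * |y' x| ^ q) volume X b)
    (h2 : IntervalIntegrable (fun x => s x * |y' x| ^ (p + q)) volume X b)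
    (h3 : IntervalIntegrable (fun x => r x ^ ((p + q) / p) * s x ^ (-q / p) *
      (∫ t in x..b, s t ^ (-1 / (p + q - 1))) ^ (p + q - 1)) volume X b) :
    ∫ x in X..b, r x * |y x| ^ p * |y' x| ^ q ≤
      ((q / (p + q)) ^ (q / (p + q)) *
          (∫ x in X..b, r x ^ ((p + q) / p) * s x ^ (-q / p) *
            (∫ t in x..b, s t ^ (-1 / (p + q - 1))) ^ (p + q - 1)) ^ (p / (p + q))) *
        ∫ x in X..b, s x * |y' x| ^ (p + q) := by
  have hn : 0 < p + q := by positivity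
  have hXb' := hXb.le
  have hsub : ∀ x ∈ Ioo X b, x ∈ Ioo a b := fun x hx => ⟨haX.trans_lt hx.1, hx.2⟩
  set G : ℝ → ℝ := fun x => ∫ t in x..b, s t * |y' t| ^ (p + q) with hGdef
  set H : ℝ → ℝ := fun x => ∫ t in x..b, s t ^ (-1 / (p + q - 1)) with hHdef
  have hgpos : ∀ x ∈ Ioo X b, 0 ≤ s x * |y' x| ^ (p + q) := fun x hx =>
    mul_nonneg (hspos x (hsub x hx)).le (by positivity)
  have hGpos : ∀ x ∈ Ico X b, 0 ≤ G x := fun x hx => by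
    simp only [hGdef, intervalIntegral.integral_of_le hx.2.le]
    exact integral_nonneg_of_ae <| ae_restrict_Ioc_of_forall_mem_Ioo fun t ht =>
      hgpos t ⟨hx.1.trans_lt ht.1, ht.2⟩
  have hHpos : ∀ x ∈ Ioo X b, 0 ≤ H x := fun x hx => by
    simp only [hHdef, intervalIntegral.integral_of_le hx.2.le]
    exact integral_nonneg_of_ae <| ae_restrict_Ioc_of_forall_mem_Ioo fun t ht =>
      Real.rpow_nonneg (hspos t (hsub t ⟨hx.1.trans ht.1, ht.2⟩)).le _
  have hybound : ∀ x ∈ Ioo X b,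
      |y x| ≤ H x ^ ((p + q - 1) / (p + q)) * G x ^ (1 / (p + q)) := fun x hx => by
    have hxa := hsub x hx
    rw [hAC x ⟨hxa.1.le, hxa.2.le⟩, abs_neg]
    refine (intervalIntegral.abs_integral_le_integral_abs hx.2.le).trans ?_
    refine integral_abs_le_weighted hx.2.le hpq
      (fun t ht => hspos t ⟨hxa.1.trans ht.1, ht.2⟩) (hsint.mono_set ?_) (h2.mono_set ?_)
    · rw [uIcc_of_le hx.2.le, uIcc_of_le (hxa.1.trans hxa.2).le]
      exact Icc_subset_Icc_left hxa.1.le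
    · rw [uIcc_of_le hx.2.le, uIcc_of_le hXb']
      exact Icc_subset_Icc_left hx.1.le
  have hpos3 : ∀ᵐ x ∂volume.restrict (Ioc X b),
      0 ≤ r x ^ ((p + q) / p) * s x ^ (-q / p) * H x ^ (p + q - 1) :=
    ae_restrict_Ioc_of_forall_mem_Ioo fun x hx => by
      have := hrpos x (hsub x hx)
      have := hspos x (hsub x hx)
      have := hHpos x hx
      positivity
  have hpos4 : ∀ᵐ x ∂volume.restrict (Ioc X b),
      0 ≤ G x ^ (p / q) * (s x * |y' x| ^ (p + q)) :=
    ae_restrict_Ioc_of_forall_mem_Ioo fun x hx =>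
      mul_nonneg (Real.rpow_nonneg (hGpos x ⟨hx.1.le, hx.2⟩) _) (hgpos x hx)
  have h4 := intervalIntegrable_rpow_integral_left_mul (div_pos hp hq).le h2
  have hαβ : p / (p + q) + q / (p + q) = 1 := by field
  have hle : ∫ x in X..b, r x * |y x| ^ p * |y' x| ^ q ≤
      (∫ x in X..b, r x ^ ((p + q) / p) * s x ^ (-q / p) * H x ^ (p + q - 1)) ^ (p / (p + q)) *
      (∫ x in X..b, G x ^ (p / q) * (s x * |y' x| ^ (p + q))) ^ (q / (p + q)) := by
    simp only [intervalIntegral.integral_of_le hXb']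
    refine (integral_mono_ae h1.1 (integrable_rpow_mul_rpow (div_pos hp hn) (div_pos hq hn) hαβ
      hpos3 hpos4 h3.1 h4.1) ?_).trans (integral_rpow_mul_rpow_le (div_pos hp hn)
      (div_pos hq hn) hαβ hpos3 hpos4 h3.1 h4.1)
    exact ae_restrict_Ioc_of_forall_mem_Ioo fun x hx =>
      opial_integrand_le hp hq (hrpos x (hsub x hx)) (hspos x (hsub x hx)) (hHpos x hx)
        (hGpos x ⟨hx.1.le, hx.2⟩) (abs_nonneg _) (abs_nonneg _) (hybound x hx)
  have hGX : 0 ≤ G X := hGpos X ⟨le_rfl, hXb⟩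
  have hGint : (∫ x in X..b, G x ^ (p / q) * (s x * |y' x| ^ (p + q))) ^ (q / (p + q)) =
      (q / (p + q)) ^ (q / (p + q)) * G X := by
    rw [integral_rpow_integral_left_mul (div_pos hp hq).le h2]
    change (G X ^ (p / q + 1) / (p / q + 1)) ^ (q / (p + q)) = _
    rw [show p / q + 1 = (p + q) / q by field, div_eq_mul_inv, inv_div,
      Real.mul_rpow (by positivity) (by positivity), ← Real.rpow_mul hGX,
      show (p + q) / q * (q / (p + q)) = 1 by field, Real.rpow_one, mul_comm]
  rw [hGint] at hle
  refine hle.trans_eq ?_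
  ring
end
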